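/- Let H be a Hopf algebra over a field k. The category of right Hopf partial comodules over H (geometric partial comodules over the coalgebra (H,Δ,ε) in the abelian monoidal category Mod_H of right H-modules) is equivalent to the category whose objects are pairs (V,N) consisting of a k-vector space V and an H-submodule N of V⊗H (where H acts on V⊗H by right multiplication on the second tensor factor) satisfying (V⊗Δ(H)) ∩ (N⊗H) = 0 inside V⊗H⊗H, and whose morphisms (V,N) → (V',N') are k-linear maps f : V → V' with (f⊗H)(N) ⊆ N'. -/

import Mathlib

open TensorProduct

universe v u

namespace HPC

variable (k : Type u) [CommRing k]
variable (B : Type u) [Ring B] [Bialgebra k B]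

section Defs

variable {N N' : Type u} [AddCommGroup N] [Module k N] [AddCommGroup N'] [Module k N']

variable {k B}

/-- A (unital, associative) right `B`-module structure on `N`, given as an uncurried
action map `N ⊗ B → N`. -/
def IsRightModule (α : N ⊗[k] B →ₗ[k] N) : Prop :=
  (∀ n : N, α (n ⊗ₜ[k] (1 : B)) = n) ∧
    ∀ (n : N) (a b : B), α (α (n ⊗ₜ[k] a) ⊗ₜ[k] b) = α (n ⊗ₜ[k] (a * b))

/-- The operator `n ↦ n·b` of a right action. -/
noncomputable def actOn (α : N ⊗[k] B →ₗ[k] N) (b : B) : N →ₗ[k] N :=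
  α ∘ₗ (TensorProduct.mk k N B).flip b

/-- The diagonal right `B`-action on `N ⊗ B`:
`(n ⊗ h)·b = (n·b₍₁₎) ⊗ (h·b₍₂₎)` (Sweedler notation). -/
noncomputable def diagAct (α : N ⊗[k] B →ₗ[k] N) :
    (N ⊗[k] B) ⊗[k] B →ₗ[k] N ⊗[k] B :=
  TensorProduct.map α (LinearMap.mul' k B) ∘ₗ
    (TensorProduct.tensorTensorTensorComm k N B B B).toLinearMap ∘ₗ
      LinearMap.lTensor (N ⊗[k] B) (Coalgebra.comul (R := k) (A := B))

/-- `B`-linearity of a map with respect to given right actions. -/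
def IsBLinear (α : N ⊗[k] B →ₗ[k] N) (α' : N' ⊗[k] B →ₗ[k] N') (f : N →ₗ[k] N') : Prop :=
  ∀ (n : N) (b : B), f (α (n ⊗ₜ[k] b)) = α' (f n ⊗ₜ[k] b)

end Defs

section PO

variable {A P W : Type u} [AddCommGroup A] [Module k A] [AddCommGroup P] [Module k P]
  [AddCommGroup W] [Module k W]

variable {k}

/-- The pushout, in `k`-modules, of `π : A → P` and `g : A → W`. -/
def PO (π : A →ₗ[k] P) (g : A →ₗ[k] W) : Type u :=
  (P × W) ⧸ LinearMap.range (π.prod (-g))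

instance (π : A →ₗ[k] P) (g : A →ₗ[k] W) : AddCommGroup (PO π g) :=
  inferInstanceAs (AddCommGroup ((P × W) ⧸ LinearMap.range (π.prod (-g))))

instance (π : A →ₗ[k] P) (g : A →ₗ[k] W) : Module k (PO π g) :=
  inferInstanceAs (Module k ((P × W) ⧸ LinearMap.range (π.prod (-g))))

/-- The projection from `P × W` onto the pushout. -/
def poMk (π : A →ₗ[k] P) (g : A →ₗ[k] W) : P × W →ₗ[k] PO π g :=
  (LinearMap.range (π.prod (-g))).mkQ

/-- The first leg of the pushout. -/
def poInl (π : A →ₗ[k] P) (g : A →ₗ[k] W) : P →ₗ[k] PO π g :=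
  poMk π g ∘ₗ LinearMap.inl k P W

/-- The second leg of the pushout. -/
def poInr (π : A →ₗ[k] P) (g : A →ₗ[k] W) : W →ₗ[k] PO π g :=
  poMk π g ∘ₗ LinearMap.inr k P W

end PO

section GPCConds

variable {M P : Type u} [AddCommGroup M] [Module k M] [AddCommGroup P] [Module k P]

variable {k B}

/-- `M ⊗ ε : M ⊗ B → M`. -/
noncomputable def epsMap : M ⊗[k] B →ₗ[k] M :=
  (TensorProduct.rid k M).toLinearMap ∘ₗ
    LinearMap.lTensor M (Coalgebra.counit (R := k) (A := B))

/-- `ρ ⊗ B : M ⊗ B → P ⊗ B`. -/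
noncomputable def G1 (ρ : M →ₗ[k] P) : M ⊗[k] B →ₗ[k] P ⊗[k] B :=
  LinearMap.rTensor B ρ

/-- `(π ⊗ B) ∘ (M ⊗ Δ) : M ⊗ B → P ⊗ B`. -/
noncomputable def G2 (π : M ⊗[k] B →ₗ[k] P) : M ⊗[k] B →ₗ[k] P ⊗[k] B :=
  LinearMap.rTensor B π ∘ₗ (TensorProduct.assoc k M B B).symm.toLinearMap ∘ₗ
    LinearMap.lTensor M (Coalgebra.comul (R := k) (A := B))

/-- (GPC1) in `Vect_k`. -/
noncomputable def VectCounital (π : M ⊗[k] B →ₗ[k] P) (ρ : M →ₗ[k] P) : Prop :=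
  ∃ e : P →ₗ[k] M, e ∘ₗ π = epsMap ∧ e ∘ₗ ρ = LinearMap.id

/-- (GPC1) in `Mod_B`: the mediating morphism is moreover `B`-linear. -/
noncomputable def ModBCounital (αM : M ⊗[k] B →ₗ[k] M) (αP : P ⊗[k] B →ₗ[k] P)
    (π : M ⊗[k] B →ₗ[k] P) (ρ : M →ₗ[k] P) : Prop :=
  ∃ e : P →ₗ[k] M, e ∘ₗ π = epsMap ∧ e ∘ₗ ρ = LinearMap.id ∧ IsBLinear αP αM e

/-- (GPC2) in `Vect_k`. -/
noncomputable def VectCoassoc (π : M ⊗[k] B →ₗ[k] P) (ρ : M →ₗ[k] P) : Prop :=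
  ∃ θ : PO π (G2 π) ≃ₗ[k] PO π (G1 ρ),
    θ.toLinearMap ∘ₗ poInl π (G2 π) ∘ₗ ρ = poInl π (G1 ρ) ∘ₗ ρ ∧
    θ.toLinearMap ∘ₗ poInr π (G2 π) = poInr π (G1 ρ)

/-- The componentwise action of `b ∈ B` on `P × (P ⊗ B)`, using the action on `P` and
the diagonal action on `P ⊗ B`. -/
noncomputable def prodAct (αP : P ⊗[k] B →ₗ[k] P) (b : B) :
    P × (P ⊗[k] B) →ₗ[k] P × (P ⊗[k] B) :=
  (actOn αP b).prodMap (actOn (diagAct αP) b)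

/-- (GPC2) in `Mod_B`: the pushouts carry the induced right `B`-module structures and
the mediating isomorphism is `B`-linear. -/
noncomputable def ModBCoassoc (αP : P ⊗[k] B →ₗ[k] P)
    (π : M ⊗[k] B →ₗ[k] P) (ρ : M →ₗ[k] P) : Prop :=
  ∃ (β₂ : PO π (G2 π) ⊗[k] B →ₗ[k] PO π (G2 π))
    (β₁ : PO π (G1 ρ) ⊗[k] B →ₗ[k] PO π (G1 ρ))
    (θ : PO π (G2 π) ≃ₗ[k] PO π (G1 ρ)),
    IsRightModule β₂ ∧ IsRightModule β₁ ∧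
    (∀ (x : P × (P ⊗[k] B)) (b : B),
      β₂ (poMk π (G2 π) x ⊗ₜ[k] b) = poMk π (G2 π) (prodAct αP b x)) ∧
    (∀ (x : P × (P ⊗[k] B)) (b : B),
      β₁ (poMk π (G1 ρ) x ⊗ₜ[k] b) = poMk π (G1 ρ) (prodAct αP b x)) ∧
    (θ.toLinearMap ∘ₗ poInl π (G2 π) ∘ₗ ρ = poInl π (G1 ρ) ∘ₗ ρ ∧
      θ.toLinearMap ∘ₗ poInr π (G2 π) = poInr π (G1 ρ)) ∧
    IsBLinear β₂ β₁ θ.toLinearMap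

end GPCConds

end HPC

namespace HPC

variable (k : Type u) [Field k]
variable (B : Type u) [Ring B] [HopfAlgebra k B]

/-- A right Hopf partial comodule over the Hopf algebra `B`: a geometric partial
comodule over the coalgebra `(B,Δ,ε)` in the monoidal category of right `B`-modules. -/
structure HopfPCObj where
  M : Type u
  [addCommGroupM : AddCommGroup M]
  [moduleM : Module k M]
  αM : M ⊗[k] B →ₗ[k] M
  hM : IsRightModule αM
  P : Type u
  [addCommGroupP : AddCommGroup P]
  [moduleP : Module k P]
  αP : P ⊗[k] B →ₗ[k] P
  hP : IsRightModule αP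
  π : M ⊗[k] B →ₗ[k] P
  surj : Function.Surjective π
  πB : IsBLinear (diagAct αM) αP π
  ρ : M →ₗ[k] P
  ρB : IsBLinear αM αP ρ
  counital : ModBCounital αM αP π ρ
  coassoc : ModBCoassoc αP π ρ

attribute [instance] HopfPCObj.addCommGroupM HopfPCObj.moduleM HopfPCObj.addCommGroupP
  HopfPCObj.moduleP

variable {k B}

/-- Morphisms of right Hopf partial comodules. -/
@[ext] structure HopfPCHom (X Y : HopfPCObj k B) where
  f : X.M →ₗ[k] Y.M
  fB : IsBLinear X.αM Y.αM f
  fH : X.P →ₗ[k] Y.P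
  fHB : IsBLinear X.αP Y.αP fH
  comm_ρ : fH ∘ₗ X.ρ = Y.ρ ∘ₗ f
  comm_π : fH ∘ₗ X.π = Y.π ∘ₗ LinearMap.rTensor B f

open CategoryTheory in
instance : Category (HopfPCObj k B) where
  Hom := HopfPCHom
  id X :=
    { f := LinearMap.id
      fB := fun n b => rfl
      fH := LinearMap.id
      fHB := fun n b => rfl
      comm_ρ := rfl
      comm_π := by ext x; simp }
  comp {X Y Z} g h :=
    { f := h.f ∘ₗ g.f
      fB := fun n b => by simp [g.fB n b, h.fB (g.f n) b]
      fH := h.fH ∘ₗ g.fH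
      fHB := fun n b => by simp [g.fHB n b, h.fHB (g.fH n) b]
      comm_ρ := by
        rw [LinearMap.comp_assoc, g.comm_ρ, ← LinearMap.comp_assoc, h.comm_ρ,
          LinearMap.comp_assoc]
      comm_π := by
        rw [LinearMap.comp_assoc, g.comm_π, ← LinearMap.comp_assoc, h.comm_π,
          LinearMap.comp_assoc, LinearMap.rTensor_comp] }
  id_comp f := by apply HopfPCHom.ext <;> rfl
  comp_id f := by apply HopfPCHom.ext <;> rfl
  assoc f g h := by apply HopfPCHom.ext <;> rfl

variable (k B)

/-- A pair `(V,N)` of a `k`-vector space `V` and an `H`-submodule `N ⊆ V ⊗ H`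
(for the action of `H` by right multiplication on the second tensor factor) such that
`(V ⊗ Δ(H)) ∩ (N ⊗ H) = 0` inside `V ⊗ H ⊗ H`. -/
structure HopfPairObj where
  V : Type u
  [addCommGroupV : AddCommGroup V]
  [moduleV : Module k V]
  N : Submodule k (V ⊗[k] B)
  submod : ∀ x ∈ N, ∀ b : B, LinearMap.lTensor V (LinearMap.mulRight k b) x ∈ N
  disj : LinearMap.range ((TensorProduct.assoc k V B B).symm.toLinearMap ∘ₗ
      LinearMap.lTensor V (Coalgebra.comul (R := k) (A := B))) ⊓
    LinearMap.range (LinearMap.rTensor B N.subtype) = ⊥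

attribute [instance] HopfPairObj.addCommGroupV HopfPairObj.moduleV

variable {k B}

/-- Morphisms of pairs. -/
@[ext] structure HopfPairHom (X Y : HopfPairObj k B) where
  f : X.V →ₗ[k] Y.V
  maps : ∀ x ∈ X.N, LinearMap.rTensor B f x ∈ Y.N

open CategoryTheory in
instance : Category (HopfPairObj k B) where
  Hom := HopfPairHom
  id X :=
    { f := LinearMap.id
      maps := fun x hx => by simpa [LinearMap.rTensor_id] using hx }
  comp {X Y Z} g h :=
    { f := h.f ∘ₗ g.f
      maps := fun x hx => by
        rw [LinearMap.rTensor_comp]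
        exact h.maps _ (g.maps x hx) }
  id_comp f := by apply HopfPairHom.ext; rfl
  comp_id f := by apply HopfPairHom.ext; rfl
  assoc f g h := by apply HopfPairHom.ext; rfl

end HPC

namespace HPC

section General

variable {k : Type u} [CommRing k] {B : Type u} [Ring B] [Bialgebra k B]
variable {M N X Y Z : Type u} [AddCommGroup M] [Module k M] [AddCommGroup N] [Module k N]
  [AddCommGroup X] [Module k X] [AddCommGroup Y] [Module k Y] [AddCommGroup Z] [Module k Z]

lemma exists_comp_eq_of_surjective {q : X →ₗ[k] Y} (hq : Function.Surjective q) (r : X →ₗ[k] Z)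
    (h : ∀ x, q x = 0 → r x = 0) : ∃ g : Y →ₗ[k] Z, ∀ x, g (q x) = r x := by
  refine ⟨(LinearMap.ker q).liftQ r (fun x hx => h x hx) ∘ₗ
    (q.quotKerEquivOfSurjective hq).symm.toLinearMap, fun x => ?_⟩
  have : (q.quotKerEquivOfSurjective hq).symm (q x) = (LinearMap.ker q).mkQ x := by
    rw [LinearEquiv.symm_apply_eq]; rfl
  rw [LinearMap.comp_apply, LinearEquiv.coe_coe, this]
  exact Submodule.liftQ_apply _ _ _

@[simp] lemma epsMap_tmul (m : M) (b : B) :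
    epsMap (k := k) (m ⊗ₜ[k] b) = Coalgebra.counit (R := k) b • m := by
  simp [epsMap]

lemma epsMap_comp_rTensor (f : X →ₗ[k] Y) :
    epsMap (B := B) ∘ₗ LinearMap.rTensor B f = f ∘ₗ epsMap := by
  ext x b; simp

lemma epsMap_rTensor (f : X →ₗ[k] Y) (x : X ⊗[k] B) :
    epsMap (LinearMap.rTensor B f x) = f (epsMap x) :=
  LinearMap.congr_fun (epsMap_comp_rTensor f) x

lemma G2_tmul (p : X ⊗[k] B →ₗ[k] Y) (x : X) (b : B) :
    G2 p (x ⊗ₜ[k] b) =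
      LinearMap.rTensor B (p ∘ₗ TensorProduct.mk k X B x) (Coalgebra.comul (R := k) b) := by
  simp only [G2, LinearMap.comp_apply, LinearMap.lTensor_tmul, LinearEquiv.coe_coe]
  induction Coalgebra.comul (R := k) b with
  | zero => simp
  | tmul a c => simp
  | add s t hs ht => simp only [TensorProduct.tmul_add, map_add, hs, ht]

lemma rTensor_comp_G2 (f : Y →ₗ[k] Z) (p : X ⊗[k] B →ₗ[k] Y) :
    LinearMap.rTensor B f ∘ₗ G2 p = G2 (f ∘ₗ p) := by
  simp only [G2, LinearMap.rTensor_comp, LinearMap.comp_assoc]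

lemma G2_comp_rTensor (p : Y ⊗[k] B →ₗ[k] Z) (f : X →ₗ[k] Y) :
    G2 p ∘ₗ LinearMap.rTensor B f = G2 (p ∘ₗ LinearMap.rTensor B f) := by
  ext x b
  simp only [TensorProduct.AlgebraTensorModule.curry_apply, TensorProduct.curry_apply,
    LinearMap.coe_restrictScalars, LinearMap.comp_apply, LinearMap.rTensor_tmul, G2_tmul]
  congr 2

lemma epsMap_comp_G2 (p : X ⊗[k] B →ₗ[k] Y) : epsMap ∘ₗ G2 p = p := by
  ext x b
  simp only [TensorProduct.AlgebraTensorModule.curry_apply, TensorProduct.curry_apply,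
    LinearMap.coe_restrictScalars, LinearMap.comp_apply, G2_tmul]
  have h := Coalgebra.lTensor_counit_comul (R := k) b
  have key : ∀ t : B ⊗[k] B, epsMap (LinearMap.rTensor B (p ∘ₗ TensorProduct.mk k X B x) t) =
      p (x ⊗ₜ[k] TensorProduct.rid k B (LinearMap.lTensor B Coalgebra.counit t)) := by
    intro t
    induction t with
    | zero => simp
    | tmul a c => simp
    | add s t hs ht => simp only [TensorProduct.tmul_add, map_add, hs, ht]
  rw [key, h]
  simp

lemma epsMap_G2 (p : X ⊗[k] B →ₗ[k] Y) (x : X ⊗[k] B) : epsMap (G2 p x) = p x :=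
  LinearMap.congr_fun (epsMap_comp_G2 p) x

lemma G2_epsMap : G2 (epsMap (M := X) (B := B) (k := k)) = LinearMap.id := by
  ext x b
  simp only [TensorProduct.AlgebraTensorModule.curry_apply, TensorProduct.curry_apply,
    LinearMap.coe_restrictScalars, LinearMap.id_apply, G2_tmul]
  have h := Coalgebra.rTensor_counit_comul (R := k) b
  have key : ∀ t : B ⊗[k] B, LinearMap.rTensor B (epsMap ∘ₗ TensorProduct.mk k X B x) t =
      x ⊗ₜ[k] TensorProduct.lid k B (LinearMap.rTensor B Coalgebra.counit t) := by
    intro t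
    induction t with
    | zero => simp
    | tmul a c => simp [TensorProduct.smul_tmul]
    | add s t hs ht => simp only [TensorProduct.tmul_add, map_add, hs, ht]
  rw [key, h]
  simp

lemma G2_comp_G2 (r : Y ⊗[k] B →ₗ[k] Z) (p : X ⊗[k] B →ₗ[k] Y) :
    G2 r ∘ₗ G2 p = G2 (r ∘ₗ G2 p) := by
  ext x b
  simp only [TensorProduct.AlgebraTensorModule.curry_apply, TensorProduct.curry_apply,
    LinearMap.coe_restrictScalars, LinearMap.comp_apply, G2_tmul]
  have key1 : ∀ t : B ⊗[k] B, G2 r (LinearMap.rTensor B (p ∘ₗ TensorProduct.mk k X B x) t) =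
      LinearMap.rTensor B (r ∘ₗ LinearMap.rTensor B (p ∘ₗ TensorProduct.mk k X B x))
        ((TensorProduct.assoc k B B B).symm (LinearMap.lTensor B Coalgebra.comul t)) := by
    intro t
    induction t with
    | zero => simp
    | tmul a c =>
      simp only [LinearMap.rTensor_tmul, G2_tmul, LinearMap.lTensor_tmul]
      induction Coalgebra.comul (R := k) c with
      | zero => simp
      | tmul a c => simp
      | add s t hs ht => simp only [TensorProduct.tmul_add, map_add, hs, ht]
    | add s t hs ht => simp only [map_add, hs, ht]
  have key2 : ∀ t : B ⊗[k] B,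
      LinearMap.rTensor B ((r ∘ₗ G2 p) ∘ₗ TensorProduct.mk k X B x) t =
      LinearMap.rTensor B (r ∘ₗ LinearMap.rTensor B (p ∘ₗ TensorProduct.mk k X B x))
        (LinearMap.rTensor B Coalgebra.comul t) := by
    intro t
    induction t with
    | zero => simp
    | tmul a c => simp [G2_tmul]
    | add s t hs ht => simp only [map_add, hs, ht]
  rw [key1, key2, ← Coalgebra.coassoc_apply, LinearEquiv.symm_apply_apply]

lemma diagAct_tmul (α : M ⊗[k] B →ₗ[k] M) (m : M) (h b : B) :
    diagAct α ((m ⊗ₜ[k] h) ⊗ₜ[k] b) =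
      TensorProduct.map (α ∘ₗ TensorProduct.mk k M B m) (LinearMap.mulLeft k h)
        (Coalgebra.comul (R := k) b) := by
  simp only [diagAct, LinearMap.comp_apply, LinearMap.lTensor_tmul, LinearEquiv.coe_coe]
  induction Coalgebra.comul (R := k) b with
  | zero => simp
  | tmul a c => simp
  | add s t hs ht => simp only [TensorProduct.tmul_add, map_add, hs, ht]

lemma diagAct_one_tmul (α : M ⊗[k] B →ₗ[k] M) (m : M) (b : B) :
    diagAct α ((m ⊗ₜ[k] (1 : B)) ⊗ₜ[k] b) = G2 α (m ⊗ₜ[k] b) := by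
  rw [diagAct_tmul, G2_tmul, LinearMap.rTensor]
  congr 2
  ext; simp

lemma isBLinear_tmul_ext {α : (X ⊗[k] Y) ⊗[k] B →ₗ[k] X ⊗[k] Y} {α' : Z ⊗[k] B →ₗ[k] Z}
    {f : X ⊗[k] Y →ₗ[k] Z}
    (h : ∀ x y b, f (α ((x ⊗ₜ[k] y) ⊗ₜ[k] b)) = α' (f (x ⊗ₜ[k] y) ⊗ₜ[k] b)) :
    IsBLinear α α' f := by
  intro n b
  induction n with
  | zero => simp
  | tmul x y => exact h x y b
  | add s t hs ht => simp only [TensorProduct.add_tmul, map_add, hs, ht]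

lemma IsBLinear.comp {α : X ⊗[k] B →ₗ[k] X} {β : Y ⊗[k] B →ₗ[k] Y} {γ : Z ⊗[k] B →ₗ[k] Z}
    {g : Y →ₗ[k] Z} {f : X →ₗ[k] Y} (hg : IsBLinear β γ g) (hf : IsBLinear α β f) :
    IsBLinear α γ (g ∘ₗ f) := fun n b => by
  simp only [LinearMap.comp_apply, hf n b, hg (f n) b]

lemma IsBLinear.comp_eq {α : X ⊗[k] B →ₗ[k] X} {β : Y ⊗[k] B →ₗ[k] Y} {f : X →ₗ[k] Y}
    (hf : IsBLinear α β f) : β ∘ₗ LinearMap.rTensor B f = f ∘ₗ α := by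
  ext x b
  simpa using (hf x b).symm

lemma diagAct_epsMap (x : X ⊗[k] B) (b : B) :
    diagAct epsMap (x ⊗ₜ[k] b) = LinearMap.lTensor X (LinearMap.mulRight k b) x := by
  induction x with
  | zero => simp
  | tmul m h =>
    rw [diagAct_tmul]
    have key : ∀ t : B ⊗[k] B,
        TensorProduct.map (epsMap ∘ₗ TensorProduct.mk k X B m) (LinearMap.mulLeft k h) t =
        m ⊗ₜ[k] (h * TensorProduct.lid k B (LinearMap.rTensor B Coalgebra.counit t)) := by
      intro t
      induction t with
      | zero => simp
      | tmul a c => simp [TensorProduct.smul_tmul]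
      | add s t hs ht => simp only [TensorProduct.tmul_add, map_add, mul_add, hs, ht]
    rw [key, Coalgebra.rTensor_counit_comul]
    simp
  | add s t hs ht => simp only [TensorProduct.add_tmul, map_add, hs, ht]

lemma IsRightModule.isBLinear_smul {α : M ⊗[k] B →ₗ[k] M} (hα : IsRightModule α) :
    IsBLinear (diagAct epsMap) α α :=
  isBLinear_tmul_ext fun m h b => by simp [diagAct_epsMap, hα.2]

lemma isRightModule_epsMap : IsRightModule (epsMap (M := X) (B := B) (k := k)) :=
  ⟨fun n => by simp, fun n a b => by simp [smul_smul, mul_comm]⟩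

lemma IsRightModule.diagAct {α : M ⊗[k] B →ₗ[k] M} (hα : IsRightModule α) :
    IsRightModule (diagAct α) := by
  constructor
  · intro n
    induction n with
    | zero => simp
    | tmul m h =>
      simp [diagAct_tmul, Algebra.TensorProduct.one_def, hα.1]
    | add s t hs ht => simp only [TensorProduct.add_tmul, map_add, hs, ht]
  · intro n a b
    induction n with
    | zero => simp
    | tmul m h =>
      simp only [diagAct_tmul, Bialgebra.comul_mul]
      induction Coalgebra.comul (R := k) a with
      | zero => simp
      | tmul a₁ a₂ =>
        simp only [TensorProduct.map_tmul, diagAct_tmul]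
        induction Coalgebra.comul (R := k) b with
        | zero => simp
        | tmul b₁ b₂ => simp [hα.2]
        | add s t hs ht => simp only [map_add, mul_add, hs, ht]
      | add s t hs ht => simp only [TensorProduct.add_tmul, map_add, add_mul, hs, ht]
    | add s t hs ht => simp only [TensorProduct.add_tmul, map_add, hs, ht]

lemma isBLinear_epsMap (α : M ⊗[k] B →ₗ[k] M) : IsBLinear (diagAct α) α epsMap := by
  refine isBLinear_tmul_ext fun m h b => ?_
  rw [diagAct_tmul]
  have key : ∀ t : B ⊗[k] B,
      epsMap (TensorProduct.map (α ∘ₗ TensorProduct.mk k M B m) (LinearMap.mulLeft k h) t) =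
      Coalgebra.counit (R := k) h •
        α (m ⊗ₜ[k] TensorProduct.rid k B (LinearMap.lTensor B Coalgebra.counit t)) := by
    intro t
    induction t with
    | zero => simp
    | tmul a c => simp [smul_smul]
    | add s t hs ht => simp only [TensorProduct.tmul_add, map_add, smul_add, hs, ht]
  rw [key, Coalgebra.lTensor_counit_comul]
  simp [← TensorProduct.smul_tmul']

lemma IsBLinear.rTensor {α : X ⊗[k] B →ₗ[k] X} {β : Y ⊗[k] B →ₗ[k] Y} {f : X →ₗ[k] Y}
    (hf : IsBLinear α β f) :
    IsBLinear (HPC.diagAct α) (HPC.diagAct β) (LinearMap.rTensor B f) := by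
  refine isBLinear_tmul_ext fun x h b => ?_
  rw [LinearMap.rTensor_tmul, diagAct_tmul, diagAct_tmul]
  induction Coalgebra.comul (R := k) b with
  | zero => simp
  | tmul a c => simp [hf x a]
  | add s t hs ht => simp only [map_add, hs, ht]

lemma isBLinear_G2_id (α : M ⊗[k] B →ₗ[k] M) :
    IsBLinear (diagAct α) (diagAct (diagAct α)) (G2 LinearMap.id) := by
  refine isBLinear_tmul_ext fun m h b => ?_
  have key1 : ∀ t : B ⊗[k] B,
      G2 LinearMap.id
        (TensorProduct.map (α ∘ₗ TensorProduct.mk k M B m) (LinearMap.mulLeft k h) t) =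
      (TensorProduct.assoc k M B B).symm (TensorProduct.map (α ∘ₗ TensorProduct.mk k M B m)
        (LinearMap.mulLeft k (Coalgebra.comul (R := k) h))
        (LinearMap.lTensor B Coalgebra.comul t)) := by
    intro t
    induction t with
    | zero => simp
    | tmul a c => simp [G2]
    | add s t hs ht => simp only [map_add, hs, ht]
  rw [diagAct_tmul, key1, ← Coalgebra.coassoc_apply]
  simp only [G2, LinearMap.rTensor_id, LinearMap.id_comp, LinearMap.comp_apply,
    LinearMap.lTensor_tmul, LinearEquiv.coe_coe]
  induction Coalgebra.comul (R := k) h with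
  | zero => simp
  | tmul h₁ h₂ =>
    rw [TensorProduct.assoc_symm_tmul, diagAct_tmul]
    induction Coalgebra.comul (R := k) b with
    | zero => simp
    | tmul b₁ b₂ =>
      simp only [LinearMap.rTensor_tmul, TensorProduct.map_tmul, LinearMap.comp_apply,
        TensorProduct.mk_apply, diagAct_tmul, LinearMap.mulLeft_apply]
      induction Coalgebra.comul (R := k) b₁ with
      | zero => simp
      | tmul c d => simp
      | add s t hs ht => simp only [TensorProduct.add_tmul, map_add, hs, ht]
    | add s t hs ht => simp only [map_add, hs, ht]
  | add s t hs ht =>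
    have : LinearMap.mulLeft k (s + t) = LinearMap.mulLeft k s + LinearMap.mulLeft k t := by
      ext; simp [add_mul]
    simp only [TensorProduct.tmul_add, TensorProduct.add_tmul, map_add, this,
      TensorProduct.map_add_right, LinearMap.add_apply, hs, ht]

lemma IsBLinear.G2 {α : X ⊗[k] B →ₗ[k] X} {β : Y ⊗[k] B →ₗ[k] Y} {p : X ⊗[k] B →ₗ[k] Y}
    (hp : IsBLinear (HPC.diagAct α) β p) :
    IsBLinear (HPC.diagAct α) (HPC.diagAct β) (HPC.G2 p) := by
  have : HPC.G2 p = LinearMap.rTensor B p ∘ₗ HPC.G2 LinearMap.id := by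
    rw [rTensor_comp_G2, LinearMap.comp_id]
  rw [this]
  exact hp.rTensor.comp (isBLinear_G2_id α)

/-- The action induced on a quotient by a stable submodule. -/
noncomputable def quotAct (α : X ⊗[k] B →ₗ[k] X) (S : Submodule k X)
    (h : ∀ x ∈ S, ∀ b : B, α (x ⊗ₜ[k] b) ∈ S) : (X ⧸ S) ⊗[k] B →ₗ[k] X ⧸ S :=
  TensorProduct.lift (S.liftQ ((TensorProduct.curry α).compr₂ S.mkQ) (fun x hx => by
    ext b
    simpa using h x hx b))

@[simp] lemma quotAct_mkQ (α : X ⊗[k] B →ₗ[k] X) (S : Submodule k X)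
    (h : ∀ x ∈ S, ∀ b : B, α (x ⊗ₜ[k] b) ∈ S) (x : X) (b : B) :
    quotAct α S h (S.mkQ x ⊗ₜ[k] b) = S.mkQ (α (x ⊗ₜ[k] b)) := by
  rw [quotAct, TensorProduct.lift.tmul]
  exact LinearMap.congr_fun (Submodule.liftQ_apply _ _ x) b

lemma IsRightModule.quotAct {α : X ⊗[k] B →ₗ[k] X} (hα : IsRightModule α) (S : Submodule k X)
    (h : ∀ x ∈ S, ∀ b : B, α (x ⊗ₜ[k] b) ∈ S) : IsRightModule (quotAct α S h) := by
  constructor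
  · intro n
    obtain ⟨x, rfl⟩ := S.mkQ_surjective n
    rw [quotAct_mkQ, hα.1]
  · intro n a b
    obtain ⟨x, rfl⟩ := S.mkQ_surjective n
    rw [quotAct_mkQ, quotAct_mkQ, quotAct_mkQ, hα.2]

/-- The componentwise action on `P × (P ⊗ B)`. -/
noncomputable def prodDiagAct (αP : Y ⊗[k] B →ₗ[k] Y) :
    (Y × (Y ⊗[k] B)) ⊗[k] B →ₗ[k] Y × (Y ⊗[k] B) :=
  (αP ∘ₗ LinearMap.rTensor B (LinearMap.fst k Y (Y ⊗[k] B))).prod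
    (diagAct αP ∘ₗ LinearMap.rTensor B (LinearMap.snd k Y (Y ⊗[k] B)))

lemma prodDiagAct_tmul (αP : Y ⊗[k] B →ₗ[k] Y) (x : Y × (Y ⊗[k] B)) (b : B) :
    prodDiagAct αP (x ⊗ₜ[k] b) = prodAct αP b x := by
  simp [prodDiagAct, prodAct, actOn]

lemma IsRightModule.prodDiagAct {αP : Y ⊗[k] B →ₗ[k] Y} (h : IsRightModule αP) :
    IsRightModule (prodDiagAct αP) :=
  ⟨fun n => by simp [HPC.prodDiagAct, h.1, h.diagAct.1],
    fun n a b => by simp [HPC.prodDiagAct, h.2, h.diagAct.2]⟩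

lemma exists_pushout_act {αM : M ⊗[k] B →ₗ[k] M} {αP : Y ⊗[k] B →ₗ[k] Y} (hP : IsRightModule αP)
    {π : M ⊗[k] B →ₗ[k] Y} (hπ : IsBLinear (diagAct αM) αP π)
    {g : M ⊗[k] B →ₗ[k] Y ⊗[k] B} (hg : IsBLinear (diagAct αM) (diagAct αP) g) :
    ∃ β : PO π g ⊗[k] B →ₗ[k] PO π g, IsRightModule β ∧
      ∀ (x : Y × (Y ⊗[k] B)) (b : B),
        β (poMk π g x ⊗ₜ[k] b) = poMk π g (prodAct αP b x) := by
  have hS : ∀ x ∈ LinearMap.range (π.prod (-g)), ∀ b : B,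
      prodDiagAct αP (x ⊗ₜ[k] b) ∈ LinearMap.range (π.prod (-g)) := by
    rintro _ ⟨x, rfl⟩ b
    refine ⟨diagAct αM (x ⊗ₜ[k] b), ?_⟩
    simp [prodDiagAct, hπ x b, hg x b, TensorProduct.neg_tmul]
  refine ⟨quotAct (prodDiagAct αP) _ hS, hP.prodDiagAct.quotAct _ hS, fun x b => ?_⟩
  rw [← prodDiagAct_tmul]
  exact quotAct_mkQ _ _ hS x b

lemma poMk_surjective (π : X →ₗ[k] Y) (g : X →ₗ[k] Z) : Function.Surjective (poMk π g) :=
  Submodule.mkQ_surjective _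

lemma poMk_eq_zero {π : X →ₗ[k] Y} {g : X →ₗ[k] Z} {y : Y × Z} :
    poMk π g y = 0 ↔ ∃ x, π x = y.1 ∧ -g x = y.2 := by
  change (LinearMap.range (π.prod (-g))).mkQ y = 0 ↔ _
  simp [Prod.ext_iff]

lemma poInl_comp (π : X →ₗ[k] Y) (g : X →ₗ[k] Z) (x : X) :
    poInl π g (π x) = poInr π g (g x) := by
  rw [← sub_eq_zero]
  simp only [poInl, poInr, LinearMap.comp_apply, ← map_sub]
  exact poMk_eq_zero.2 ⟨x, by simp, by simp⟩

/-- If two maps differ by a map factoring through `π`, their pushouts along `π` agree. -/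
lemma exists_pushout_equiv (π : X →ₗ[k] Y) (g g' : X →ₗ[k] Z) (d : Y →ₗ[k] Z)
    (hd : ∀ x, d (π x) = g x - g' x) :
    ∃ θ : PO π g ≃ₗ[k] PO π g', ∀ y z, θ (poMk π g (y, z)) = poMk π g' (y, z + d y) := by
  let s : (Y × Z) ≃ₗ[k] (Y × Z) := LinearEquiv.ofLinearMap
    ((LinearMap.fst k Y Z).prod (LinearMap.snd k Y Z + d ∘ₗ LinearMap.fst k Y Z))
    ((LinearMap.fst k Y Z).prod (LinearMap.snd k Y Z - d ∘ₗ LinearMap.fst k Y Z))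
    (by ext <;> simp) (by ext <;> simp)
  have hs : (LinearMap.range (π.prod (-g))).map s.toLinearMap = LinearMap.range (π.prod (-g')) := by
    rw [← LinearMap.range_comp]
    congr 1
    ext x
    · simp [s]
    · simp [s, hd, sub_eq_add_neg]
  exact ⟨Submodule.Quotient.equiv _ _ s hs, fun y z => rfl⟩

lemma modBCoassoc_of {αM : M ⊗[k] B →ₗ[k] M} {αP : Y ⊗[k] B →ₗ[k] Y} (hP : IsRightModule αP)
    {π : M ⊗[k] B →ₗ[k] Y} (hπ : IsBLinear (diagAct αM) αP π) (hs : Function.Surjective π)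
    {ρ : M →ₗ[k] Y} (hρ : IsBLinear αM αP ρ)
    (h : ∀ x m, π x = ρ m → G1 ρ x = G2 π x) : ModBCoassoc αP π ρ := by
  have h1 : IsBLinear (diagAct αM) (diagAct αP) (G1 (B := B) ρ) := hρ.rTensor
  have h2 := hπ.G2
  obtain ⟨β₂, hβ₂, hβ₂'⟩ := exists_pushout_act hP hπ h2
  obtain ⟨β₁, hβ₁, hβ₁'⟩ := exists_pushout_act hP hπ h1
  obtain ⟨d, hd⟩ := exists_comp_eq_of_surjective hs (G2 π - G1 ρ) (fun x hx => by
    rw [LinearMap.sub_apply, h x 0 (by simpa using hx), sub_self])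
  obtain ⟨θ, hθ⟩ := exists_pushout_equiv π (G2 π) (G1 ρ) d hd
  have hdB : IsBLinear αP (diagAct αP) d := by
    intro n b
    obtain ⟨x, rfl⟩ := hs n
    rw [← hπ x b, hd, hd]
    simp only [LinearMap.sub_apply, TensorProduct.sub_tmul, map_sub, h1 x b, h2 x b]
  refine ⟨β₂, β₁, θ, hβ₂, hβ₁, hβ₂', hβ₁', ⟨?_, ?_⟩, ?_⟩
  · ext m
    obtain ⟨x, hx⟩ := hs (ρ m)
    have : d (ρ m) = 0 := by rw [← hx, hd, LinearMap.sub_apply, h x m hx, sub_self]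
    simp [poInl, hθ, this]
  · refine LinearMap.ext fun w => ?_
    simp [poInr, hθ]
  · intro n b
    obtain ⟨⟨y, z⟩, rfl⟩ := poMk_surjective _ _ n
    rw [hβ₂']
    simp only [LinearEquiv.coe_coe, hθ, hβ₁']
    simp [prodAct, actOn, hdB y b]

/-- Coassociativity forces the two composites to `P ⊗ B` to agree on `π⁻¹(ρ(M))`. -/
lemma VectCoassoc.G1_eq_G2 {π : M ⊗[k] B →ₗ[k] Y} {ρ : M →ₗ[k] Y}
    (hc : VectCoassoc π ρ) (hu : VectCounital π ρ) {x : M ⊗[k] B} {m : M} (hx : π x = ρ m) :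
    G1 ρ x = G2 π x := by
  obtain ⟨θ, h1, h2⟩ := hc
  obtain ⟨e, he1, he2⟩ := hu
  have h3 : poInr π (G1 ρ) (G2 π x) = poInr π (G1 ρ) (G1 ρ x) := by
    have := LinearMap.congr_fun h1 m
    simp only [LinearMap.comp_apply, ← hx, poInl_comp] at this
    rw [← this]
    exact (LinearMap.congr_fun h2 _).symm
  rw [← sub_eq_zero, ← map_sub] at h3
  obtain ⟨y, -, hy⟩ := poMk_eq_zero.1 h3
  have e1 : ∀ z, LinearMap.rTensor B e (G1 ρ z) = z := fun z => by
    rw [G1, ← LinearMap.comp_apply, ← LinearMap.rTensor_comp, he2, LinearMap.rTensor_id]; rfl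
  have e2 : ∀ z, LinearMap.rTensor B e (G2 π z) = z := fun z => by
    rw [← LinearMap.comp_apply, rTensor_comp_G2, he1, G2_epsMap]; rfl
  replace hy : -G1 ρ y = G2 π x - G1 ρ x := hy
  have hy' := congrArg (LinearMap.rTensor B e) hy
  simp only [map_neg, map_sub, e1, e2, sub_self, neg_eq_zero] at hy'
  rw [hy'] at hy
  rw [map_zero, neg_zero, eq_comm, sub_eq_zero] at hy
  exact hy.symm

end General

end HPC

namespace HPC

section Hopf

variable {k : Type u} [Field k] {B : Type u} [Ring B] [HopfAlgebra k B]
variable {M : Type u} [AddCommGroup M] [Module k M]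

lemma IsRightModule.G2_bijective {α : M ⊗[k] B →ₗ[k] M} (hα : IsRightModule α) :
    Function.Bijective (G2 α) := by
  let r : M ⊗[k] B →ₗ[k] M := α ∘ₗ LinearMap.lTensor M (HopfAlgebra.antipode k (A := B))
  have h1 : r ∘ₗ G2 α = epsMap := by
    ext m b
    have key : ∀ t : B ⊗[k] B, r (LinearMap.rTensor B (α ∘ₗ TensorProduct.mk k M B m) t) =
        α (m ⊗ₜ[k] LinearMap.mul' k B
          (LinearMap.lTensor B (HopfAlgebra.antipode k (A := B)) t)) := by
      intro t
      induction t with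
      | zero => simp
      | tmul a c => simp [r, hα.2]
      | add s t hs ht => simp only [TensorProduct.tmul_add, map_add, hs, ht]
    simp [G2_tmul, key, HopfAlgebra.mul_antipode_lTensor_comul_apply,
      Algebra.algebraMap_eq_smul_one, hα.1]
  have h2 : α ∘ₗ G2 r = epsMap := by
    ext m b
    have key : ∀ t : B ⊗[k] B, α (LinearMap.rTensor B (r ∘ₗ TensorProduct.mk k M B m) t) =
        α (m ⊗ₜ[k] LinearMap.mul' k B
          (LinearMap.rTensor B (HopfAlgebra.antipode k (A := B)) t)) := by
      intro t
      induction t with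
      | zero => simp
      | tmul a c => simp [r, hα.2]
      | add s t hs ht => simp only [TensorProduct.tmul_add, map_add, hs, ht]
    simp [G2_tmul, key, HopfAlgebra.mul_antipode_rTensor_comul_apply,
      Algebra.algebraMap_eq_smul_one, hα.1]
  refine Function.bijective_iff_has_inverse.2 ⟨G2 r, fun x => ?_, fun x => ?_⟩
  · rw [← LinearMap.comp_apply, G2_comp_G2, h1, G2_epsMap]; rfl
  · rw [← LinearMap.comp_apply, G2_comp_G2, h2, G2_epsMap]; rfl

namespace HopfPCObj

variable (X : HopfPCObj k B)

lemma vectCounital : VectCounital X.π X.ρ :=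
  let ⟨e, h1, h2, _⟩ := X.counital
  ⟨e, h1, h2⟩

lemma vectCoassoc : VectCoassoc X.π X.ρ :=
  let ⟨_, _, θ, _, _, _, _, h, _⟩ := X.coassoc
  ⟨θ, h⟩

/-- The map `m ↦ ρ(m) - π(m ⊗ 1)`. -/
noncomputable def coinvDiff : X.M →ₗ[k] X.P :=
  X.ρ - X.π ∘ₗ (TensorProduct.mk k X.M B).flip 1

/-- The coinvariants of a partial comodule. -/
noncomputable def coinv : Submodule k X.M := LinearMap.ker X.coinvDiff

variable {X} in
lemma mem_coinv {m : X.M} : m ∈ X.coinv ↔ X.ρ m = X.π (m ⊗ₜ[k] 1) := by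
  simp [coinv, coinvDiff, sub_eq_zero]

/-- The map `V ⊗ B → M`, `v ⊗ h ↦ v·h`, where `V` is the space of coinvariants. -/
noncomputable def gen : X.coinv ⊗[k] B →ₗ[k] X.M :=
  X.αM ∘ₗ LinearMap.rTensor B X.coinv.subtype

@[simp] lemma gen_tmul (v : X.coinv) (b : B) : X.gen (v ⊗ₜ[k] b) = X.αM ((v : X.M) ⊗ₜ[k] b) := rfl

lemma isBLinear_gen : IsBLinear (diagAct epsMap) X.αM X.gen :=
  X.hM.isBLinear_smul.comp (IsBLinear.rTensor fun v b => by simp)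

lemma G2_gen : G2 X.gen = G2 X.αM ∘ₗ LinearMap.rTensor B X.coinv.subtype :=
  (G2_comp_rTensor _ _).symm

lemma G2_gen_injective : Function.Injective (G2 X.gen) := by
  rw [G2_gen, LinearMap.coe_comp]
  exact X.hM.G2_bijective.1.comp
    (Module.Flat.rTensor_preserves_injective_linearMap _ X.coinv.injective_subtype)

lemma G2_comp_rTensor_coinvDiff :
    G2 X.αP ∘ₗ LinearMap.rTensor B X.coinvDiff = (G1 X.ρ - G2 X.π) ∘ₗ G2 X.αM := by
  have h1 : G2 X.αP ∘ₗ LinearMap.rTensor B X.ρ = G1 X.ρ ∘ₗ G2 X.αM := by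
    rw [G2_comp_rTensor, X.ρB.comp_eq, G1, rTensor_comp_G2]
  have h2 : X.αP ∘ₗ LinearMap.rTensor B (X.π ∘ₗ (TensorProduct.mk k X.M B).flip 1) =
      X.π ∘ₗ G2 X.αM := by
    ext m b
    simp [← diagAct_one_tmul, X.πB (m ⊗ₜ[k] 1) b]
  rw [coinvDiff, LinearMap.rTensor_sub, LinearMap.comp_sub, h1, G2_comp_rTensor, h2,
    ← G2_comp_G2, LinearMap.sub_comp]

lemma exists_G2_gen_eq {x : X.M ⊗[k] B} {m : X.M} (hx : X.π x = X.ρ m) :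
    ∃ y, G2 X.gen y = x := by
  have h := X.vectCoassoc.G1_eq_G2 X.vectCounital hx
  obtain ⟨z, rfl⟩ := X.hM.G2_bijective.2 x
  have hz : LinearMap.rTensor B X.coinvDiff z = 0 := by
    apply X.hP.G2_bijective.1
    rw [← LinearMap.comp_apply, G2_comp_rTensor_coinvDiff]
    simp [h]
  have hex : Function.Exact X.coinv.subtype X.coinvDiff := LinearMap.exact_subtype_ker_map _
  obtain ⟨y, rfl⟩ := (Module.Flat.rTensor_exact B hex z).1 hz
  exact ⟨y, by rw [G2_gen]; rfl⟩

lemma ρ_gen (y : X.coinv ⊗[k] B) : X.ρ (X.gen y) = X.π (G2 X.gen y) := by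
  have hd : X.coinvDiff ∘ₗ X.coinv.subtype = 0 := by ext v; exact v.2
  have h : (G1 (B := B) X.ρ - G2 X.π) (G2 X.gen y) = 0 := by
    rw [G2_gen, ← LinearMap.comp_apply, ← LinearMap.comp_assoc, ← G2_comp_rTensor_coinvDiff,
      LinearMap.comp_assoc, ← LinearMap.rTensor_comp, hd]
    simp
  rw [LinearMap.sub_apply, sub_eq_zero] at h
  simpa [G1, epsMap_rTensor, epsMap_G2] using congrArg epsMap h

lemma gen_surjective : Function.Surjective X.gen := by
  intro m
  obtain ⟨x, hx⟩ := X.surj (X.ρ m)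
  obtain ⟨y, rfl⟩ := X.exists_G2_gen_eq hx
  obtain ⟨e, -, he⟩ := X.vectCounital
  rw [← X.ρ_gen] at hx
  exact ⟨y, LinearMap.injective_of_comp_eq_id _ _ he hx⟩

lemma π_eq_zero_iff {x : X.M ⊗[k] B} : X.π x = 0 ↔ ∃ y, X.gen y = 0 ∧ G2 X.gen y = x := by
  constructor
  · intro hx
    obtain ⟨y, rfl⟩ := X.exists_G2_gen_eq (m := 0) (by simpa using hx)
    obtain ⟨e, -, he⟩ := X.vectCounital
    refine ⟨y, ?_, rfl⟩
    rw [← X.ρ_gen] at hx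
    exact LinearMap.injective_of_comp_eq_id _ _ he (hx.trans (map_zero _).symm)
  · rintro ⟨y, hy, rfl⟩
    rw [← X.ρ_gen, hy, map_zero]

/-- The pair of coinvariants and relations of a partial comodule. -/
noncomputable def toPair : HopfPairObj k B where
  V := X.coinv
  N := LinearMap.ker X.gen
  submod x hx b := by
    rw [LinearMap.mem_ker] at hx ⊢
    rw [← diagAct_epsMap, X.isBLinear_gen x b, hx, TensorProduct.zero_tmul, map_zero]
  disj := by
    rw [eq_bot_iff]
    rintro _ ⟨⟨x, rfl⟩, z, hz⟩
    have h1 : G2 X.gen x = 0 := by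
      rw [G2, LinearMap.comp_apply, ← hz, ← LinearMap.comp_apply, ← LinearMap.rTensor_comp,
        LinearMap.comp_ker_subtype]
      simp
    rw [X.G2_gen_injective (h1.trans (map_zero _).symm), map_zero]
    exact Submodule.zero_mem _

end HopfPCObj

namespace HopfPCHom

variable {X Y : HopfPCObj k B}

lemma map_mem_coinv (g : HopfPCHom X Y) {m : X.M} (hm : m ∈ X.coinv) : g.f m ∈ Y.coinv := by
  rw [HopfPCObj.mem_coinv] at hm ⊢
  have h1 := LinearMap.congr_fun g.comm_ρ m
  have h2 := LinearMap.congr_fun g.comm_π (m ⊗ₜ[k] 1)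
  simp only [LinearMap.comp_apply, LinearMap.rTensor_tmul] at h1 h2
  rw [← h1, hm, h2]

/-- The restriction of a morphism to the coinvariants. -/
noncomputable def coinvMap (g : HopfPCHom X Y) : X.coinv →ₗ[k] Y.coinv :=
  g.f.restrict fun _ => g.map_mem_coinv

lemma gen_comp_rTensor (g : HopfPCHom X Y) :
    Y.gen ∘ₗ LinearMap.rTensor B g.coinvMap = g.f ∘ₗ X.gen := by
  ext v b
  exact (g.fB v b).symm

/-- The morphism of pairs induced by a morphism of partial comodules. -/
noncomputable def toPairHom (g : HopfPCHom X Y) : HopfPairHom X.toPair Y.toPair where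
  f := g.coinvMap
  maps x hx := by
    have h := LinearMap.congr_fun g.gen_comp_rTensor x
    exact h.trans ((congrArg g.f hx).trans (map_zero _))

lemma toPairHom_injective : Function.Injective (toPairHom (X := X) (Y := Y)) := by
  intro g g' h
  have h1 : g.f = g'.f := by
    have hc : g.coinvMap = g'.coinvMap := congrArg HopfPairHom.f h
    rw [← LinearMap.cancel_right X.gen_surjective, ← gen_comp_rTensor, hc, gen_comp_rTensor]
  refine HopfPCHom.ext h1 ?_
  rw [← LinearMap.cancel_right X.surj, g.comm_π, g'.comm_π, h1]

lemma toPairHom_surjective : Function.Surjective (toPairHom (X := X) (Y := Y)) := by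
  rintro ⟨(f : X.coinv →ₗ[k] Y.coinv), hf⟩
  replace hf : ∀ x, X.gen x = 0 → Y.gen (LinearMap.rTensor B f x) = 0 := hf
  obtain ⟨g, hg⟩ := exists_comp_eq_of_surjective X.gen_surjective
    (Y.gen ∘ₗ LinearMap.rTensor B f) hf
  have hg' : g ∘ₗ X.gen = Y.gen ∘ₗ LinearMap.rTensor B f := LinearMap.ext hg
  have hG : ∀ y, LinearMap.rTensor B g (G2 X.gen y) = G2 Y.gen (LinearMap.rTensor B f y) := by
    intro y
    rw [← LinearMap.comp_apply, ← LinearMap.comp_apply, rTensor_comp_G2, G2_comp_rTensor, hg']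
  obtain ⟨gH, hgH⟩ := exists_comp_eq_of_surjective X.surj
    (Y.π ∘ₗ LinearMap.rTensor B g) (fun x hx => by
      obtain ⟨y, hy, rfl⟩ := X.π_eq_zero_iff.1 hx
      exact Y.π_eq_zero_iff.2 ⟨_, hf y hy, (hG y).symm⟩)
  have hgB : IsBLinear X.αM Y.αM g := by
    have hf' : IsBLinear (diagAct epsMap) (diagAct epsMap) (LinearMap.rTensor B f) :=
      IsBLinear.rTensor fun v b => by simp
    intro n b
    obtain ⟨x, rfl⟩ := X.gen_surjective n
    rw [← X.isBLinear_gen x b, hg, hg]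
    exact (Y.isBLinear_gen.comp hf') x b
  have hgHB : IsBLinear X.αP Y.αP gH := by
    intro n b
    obtain ⟨x, rfl⟩ := X.surj n
    rw [← X.πB x b, hgH, hgH]
    exact (IsBLinear.comp Y.πB hgB.rTensor) x b
  have hρ : gH ∘ₗ X.ρ = Y.ρ ∘ₗ g := by
    refine LinearMap.ext fun n => ?_
    obtain ⟨x, rfl⟩ := X.gen_surjective n
    rw [LinearMap.comp_apply, LinearMap.comp_apply, X.ρ_gen, hgH, LinearMap.comp_apply, hG, hg,
      LinearMap.comp_apply, Y.ρ_gen]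
  refine ⟨⟨g, hgB, gH, hgHB, hρ, LinearMap.ext hgH⟩, HopfPairHom.ext (LinearMap.ext fun (v : X.coinv) => ?_)⟩
  apply Subtype.ext
  change g (v : X.coinv).1 = (f v).1
  have := hg (v ⊗ₜ[k] 1)
  rwa [LinearMap.comp_apply, LinearMap.rTensor_tmul, HopfPCObj.gen_tmul, HopfPCObj.gen_tmul,
    X.hM.1, Y.hM.1] at this

end HopfPCHom

namespace HopfPairObj

variable (A : HopfPairObj k B)

/-- The quotient map `V ⊗ B → (V ⊗ B) / N`. -/
noncomputable def quot : A.V ⊗[k] B →ₗ[k] (A.V ⊗[k] B) ⧸ A.N := A.N.mkQ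

lemma quot_surjective : Function.Surjective A.quot := Submodule.mkQ_surjective _

lemma quot_eq_zero {x : A.V ⊗[k] B} : A.quot x = 0 ↔ x ∈ A.N := by simp [quot]

/-- The action of `B` on `(V ⊗ B) / N`. -/
noncomputable def act : ((A.V ⊗[k] B) ⧸ A.N) ⊗[k] B →ₗ[k] (A.V ⊗[k] B) ⧸ A.N :=
  quotAct (diagAct epsMap) A.N fun x hx b => by
    rw [diagAct_epsMap]; exact A.submod x hx b

lemma isRightModule_act : IsRightModule A.act :=
  isRightModule_epsMap.diagAct.quotAct _ _

lemma isBLinear_quot : IsBLinear (diagAct epsMap) A.act A.quot :=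
  fun x b => (quotAct_mkQ _ _ _ x b).symm

lemma act_quot_tmul (v : A.V) (b : B) :
    A.act (A.quot (v ⊗ₜ[k] 1) ⊗ₜ[k] b) = A.quot (v ⊗ₜ[k] b) := by
  rw [← A.isBLinear_quot, diagAct_epsMap]
  simp

lemma G2_quot_injective : Function.Injective (G2 A.quot) := by
  rw [injective_iff_map_eq_zero]
  intro x hx
  have hex : Function.Exact A.N.subtype A.quot := LinearMap.exact_subtype_mkQ _
  have h0 : LinearMap.rTensor B A.quot (G2 LinearMap.id x) = 0 := by
    rw [← hx, ← LinearMap.comp_apply, rTensor_comp_G2, LinearMap.comp_id]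
  obtain ⟨z, hz⟩ := (Module.Flat.rTensor_exact B hex _).1 h0
  have h1 : G2 LinearMap.id x = 0 := by
    rw [← Submodule.mem_bot (R := k), ← A.disj]
    refine ⟨⟨x, ?_⟩, z, hz⟩
    simp [G2]
  simpa [epsMap_G2] using congrArg epsMap h1

/-- The kernel of the projection `M ⊗ B → P` of the partial comodule attached to a pair. -/
noncomputable def rel : Submodule k (((A.V ⊗[k] B) ⧸ A.N) ⊗[k] B) := A.N.map (G2 A.quot)

lemma isBLinear_G2_quot : IsBLinear (diagAct epsMap) (diagAct A.act) (G2 A.quot) :=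
  A.isBLinear_quot.G2

/-- The action of `B` on `P`. -/
noncomputable def actP :
    ((((A.V ⊗[k] B) ⧸ A.N) ⊗[k] B) ⧸ A.rel) ⊗[k] B →ₗ[k]
      (((A.V ⊗[k] B) ⧸ A.N) ⊗[k] B) ⧸ A.rel :=
  quotAct (diagAct A.act) A.rel (by
    rintro _ ⟨x, hx, rfl⟩ b
    refine ⟨diagAct epsMap (x ⊗ₜ[k] b), ?_, A.isBLinear_G2_quot x b⟩
    rw [diagAct_epsMap]
    exact A.submod x hx b)

lemma isRightModule_actP : IsRightModule A.actP :=
  A.isRightModule_act.diagAct.quotAct _ _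

/-- The partial coaction on `(V ⊗ B) / N`. -/
noncomputable def coact : (A.V ⊗[k] B) ⧸ A.N →ₗ[k] (((A.V ⊗[k] B) ⧸ A.N) ⊗[k] B) ⧸ A.rel :=
  A.N.mapQ A.rel (G2 A.quot) fun _ hx => Submodule.mem_map_of_mem hx

lemma coact_quot (x : A.V ⊗[k] B) : A.coact (A.quot x) = A.rel.mkQ (G2 A.quot x) := rfl

lemma isBLinear_mkQ : IsBLinear (diagAct A.act) A.actP A.rel.mkQ :=
  fun x b => (quotAct_mkQ _ _ _ x b).symm

lemma isBLinear_coact : IsBLinear A.act A.actP A.coact := by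
  intro n b
  obtain ⟨x, rfl⟩ := A.quot_surjective n
  rw [← A.isBLinear_quot, coact_quot, coact_quot, A.isBLinear_G2_quot, A.isBLinear_mkQ]

lemma exists_G2_quot_eq {x : ((A.V ⊗[k] B) ⧸ A.N) ⊗[k] B} {m : (A.V ⊗[k] B) ⧸ A.N}
    (hx : A.rel.mkQ x = A.coact m) : ∃ y, G2 A.quot y = x ∧ A.quot y = m := by
  obtain ⟨y, rfl⟩ := A.quot_surjective m
  rw [coact_quot, ← sub_eq_zero, ← map_sub, Submodule.mkQ_apply,
    Submodule.Quotient.mk_eq_zero] at hx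
  obtain ⟨z, hz, hz'⟩ := hx
  refine ⟨z + y, by rw [map_add, hz', sub_add_cancel], ?_⟩
  rw [map_add, A.quot_eq_zero.2 hz, zero_add]

lemma G1_coact_G2_quot : G1 A.coact ∘ₗ G2 A.quot = G2 A.rel.mkQ ∘ₗ G2 A.quot := by
  rw [G1, rTensor_comp_G2, G2_comp_G2]
  rfl

/-- The Hopf partial comodule attached to a pair. -/
noncomputable def toPC : HopfPCObj k B where
  M := (A.V ⊗[k] B) ⧸ A.N
  αM := A.act
  hM := A.isRightModule_act
  P := (((A.V ⊗[k] B) ⧸ A.N) ⊗[k] B) ⧸ A.rel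
  αP := A.actP
  hP := A.isRightModule_actP
  π := A.rel.mkQ
  surj := Submodule.mkQ_surjective _
  πB := A.isBLinear_mkQ
  ρ := A.coact
  ρB := A.isBLinear_coact
  counital := by
    have he : A.rel ≤ LinearMap.ker epsMap := by
      rintro _ ⟨x, hx, rfl⟩
      rw [LinearMap.mem_ker, epsMap_G2, A.quot_eq_zero]
      exact hx
    have he' : ∀ x, A.rel.liftQ epsMap he (A.rel.mkQ x) = epsMap x := fun x =>
      Submodule.liftQ_apply _ _ x
    refine ⟨A.rel.liftQ epsMap he, LinearMap.ext he', LinearMap.ext fun n => ?_, fun n b => ?_⟩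
    · obtain ⟨x, rfl⟩ := A.quot_surjective n
      rw [LinearMap.comp_apply, coact_quot, he', epsMap_G2, LinearMap.id_apply]
    · obtain ⟨x, rfl⟩ := A.rel.mkQ_surjective n
      rw [← A.isBLinear_mkQ, he', he', isBLinear_epsMap]
  coassoc := by
    refine modBCoassoc_of A.isRightModule_actP A.isBLinear_mkQ (Submodule.mkQ_surjective _)
      A.isBLinear_coact (fun x m hx => ?_)
    obtain ⟨y, rfl, -⟩ := A.exists_G2_quot_eq hx
    exact LinearMap.congr_fun A.G1_coact_G2_quot y

lemma tmul_one_injective {V : Type u} [AddCommGroup V] [Module k V] :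
    Function.Injective fun v : V => v ⊗ₜ[k] (1 : B) := fun v w h => by
  simpa using congrArg epsMap h

lemma quot_tmul_one_mem (v : A.V) : A.quot (v ⊗ₜ[k] 1) ∈ A.toPC.coinv := by
  refine HopfPCObj.mem_coinv.2 ?_
  change A.coact (A.quot (v ⊗ₜ[k] 1)) = A.rel.mkQ (A.quot (v ⊗ₜ[k] 1) ⊗ₜ[k] 1)
  rw [coact_quot, G2_tmul, Bialgebra.comul_one]
  simp [Algebra.TensorProduct.one_def]

/-- The map from `V` to the coinvariants of the attached partial comodule. -/
noncomputable def unitMap : A.V →ₗ[k] A.toPC.coinv :=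
  (A.quot ∘ₗ (TensorProduct.mk k A.V B).flip 1).codRestrict _ A.quot_tmul_one_mem

lemma G2_quot_tmul_one (v : A.V) :
    G2 A.quot (v ⊗ₜ[k] 1) = A.quot (v ⊗ₜ[k] 1) ⊗ₜ[k] 1 := by
  simp [G2_tmul, Algebra.TensorProduct.one_def]

lemma unitMap_bijective : Function.Bijective A.unitMap := by
  constructor
  · intro v w h
    apply tmul_one_injective (k := k) (B := B)
    apply A.G2_quot_injective
    have h' : A.quot (v ⊗ₜ[k] 1) = A.quot (w ⊗ₜ[k] 1) := congrArg Subtype.val h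
    simp only [G2_quot_tmul_one, h']
  · rintro ⟨m, hm⟩
    change (A.V ⊗[k] B) ⧸ A.N at m
    obtain ⟨y, hy, rfl⟩ := A.exists_G2_quot_eq (x := m ⊗ₜ[k] 1) (HopfPCObj.mem_coinv.1 hm).symm
    have h1 : G2 LinearMap.id y = y ⊗ₜ[k] (1 : B) := by
      apply Module.Flat.rTensor_preserves_injective_linearMap (M := B) _ A.G2_quot_injective
      rw [LinearMap.rTensor_tmul, hy, ← LinearMap.comp_apply, rTensor_comp_G2,
        LinearMap.comp_id, ← LinearMap.id_comp (G2 A.quot), ← G2_comp_G2, LinearMap.comp_apply, hy]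
      simp [G2_tmul, Algebra.TensorProduct.one_def]
    have h2 : y = epsMap y ⊗ₜ[k] (1 : B) := by
      rw [← LinearMap.rTensor_tmul, ← h1, ← LinearMap.comp_apply, rTensor_comp_G2,
        LinearMap.comp_id, G2_epsMap]
      rfl
    exact ⟨epsMap y, Subtype.ext (congrArg A.quot h2.symm)⟩

lemma gen_rTensor_unitMap (x : A.V ⊗[k] B) :
    A.toPC.gen (LinearMap.rTensor B A.unitMap x) = A.quot x := by
  induction x with
  | zero => simp only [map_zero]; rfl
  | tmul v b => exact A.act_quot_tmul v b
  | add s t hs ht => rw [map_add, map_add, map_add, hs, ht]; rfl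

open CategoryTheory in
/-- A pair is recovered from its attached partial comodule. -/
noncomputable def unitIso : A.toPC.toPair ≅ A :=
  let e := LinearEquiv.ofBijective A.unitMap A.unitMap_bijective
  have he : ∀ x, LinearMap.rTensor B A.unitMap (LinearMap.rTensor B e.symm.toLinearMap x) = x :=
    fun x => by
      rw [← LinearMap.comp_apply, ← LinearMap.rTensor_comp,
        show A.unitMap = e.toLinearMap from rfl, LinearEquiv.comp_symm, LinearMap.rTensor_id]
      rfl
  { hom :=
      { f := e.symm.toLinearMap
        maps := fun x hx => by
          rw [← A.quot_eq_zero]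
          exact (A.gen_rTensor_unitMap _).symm.trans ((congrArg A.toPC.gen (he x)).trans hx) }
    inv :=
      { f := A.unitMap
        maps := fun x hx => (A.gen_rTensor_unitMap x).trans (A.quot_eq_zero.2 hx) }
    hom_inv_id := HopfPairHom.ext (LinearMap.ext e.apply_symm_apply)
    inv_hom_id := HopfPairHom.ext (LinearMap.ext e.symm_apply_apply) }

end HopfPairObj

open CategoryTheory

variable (k B) in
/-- The functor sending a partial comodule to its pair of coinvariants and relations. -/
noncomputable def pairFunctor : HopfPCObj k B ⥤ HopfPairObj k B where
  obj X := X.toPair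
  map g := HopfPCHom.toPairHom g
  map_id _ := HopfPairHom.ext rfl
  map_comp _ _ := HopfPairHom.ext rfl

instance : (pairFunctor k B).Faithful where
  map_injective h := HopfPCHom.toPairHom_injective h

instance : (pairFunctor k B).Full where
  map_surjective := HopfPCHom.toPairHom_surjective

instance : (pairFunctor k B).EssSurj where
  mem_essImage A := ⟨A.toPC, ⟨A.unitIso⟩⟩

instance : (pairFunctor k B).IsEquivalence where

end Hopf

end HPC

open HPC in
/-- Theorem 5.7, fundamental theorem for Hopf partial comodules:
for a Hopf algebra `H` over a field `k`, the category of right Hopf partial comodules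
over `H` is equivalent to the category of pairs `(V,N)` where `V` is a `k`-vector
space and `N ⊆ V ⊗ H` is an `H`-submodule with `(V ⊗ Δ(H)) ∩ (N ⊗ H) = 0`, with
morphisms `(V,N) → (V',N')` the `k`-linear maps `f : V → V'` with `(f ⊗ H)(N) ⊆ N'`. -/
theorem statement18 (k : Type u) [Field k] (B : Type u) [Ring B] [HopfAlgebra k B] :
    Nonempty (HopfPCObj k B ≌ HopfPairObj k B) := by
  exact ⟨(pairFunctor k B).asEquivalence⟩
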